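/- Let β > 0, γ ∈ ℝ and d ≥ 1. There exists a constant C < ∞ depending only on β and γ such that for all φ, ξ ∈ ℝ^d with (φ,ξ) ≠ (0,0) and every measurable function f : ℝ → [0,∞], one has ∫_ℝ W(s,φ,ξ)^{2γ} · (∫_s^{∞} K(t,s,φ,ξ) · f(t) dt)² ds ≤ C · ∫_ℝ W(t,φ,ξ)^{2γ−4β} · f(t)² dt. -/

import Mathlib

open MeasureTheory Real
open scoped ENNReal

/-- The weight `W(t,φ,ξ) = max(‖ξ - tφ‖, ‖φ‖^{1/(1+2β)})`. -/
noncomputable def Wgt (β : ℝ) {d : ℕ} (t : ℝ) (φ ξ : EuclideanSpace ℝ (Fin d)) : ℝ :=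
  max ‖ξ - t • φ‖ (‖φ‖ ^ (1 / (1 + 2 * β)))

/-- The Kolmogorov kernel `K(t,s,φ,ξ) = exp(-∫_s^t ‖ξ - τφ‖^{2β} dτ)`. -/
noncomputable def Kker (β : ℝ) {d : ℕ} (t s : ℝ) (φ ξ : EuclideanSpace ℝ (Fin d)) : ℝ :=
  Real.exp (-(∫ τ in s..t, ‖ξ - τ • φ‖ ^ (2 * β)))

/-- A polynomially growing factor is absorbed by half of an exponential. -/
theorem exists_one_add_rpow_le_mul_exp (q : ℝ) (hq : 0 ≤ q) :
    ∃ M : ℝ, 0 ≤ M ∧ ∀ x : ℝ, 0 ≤ x → (1 + x) ^ q ≤ M * Real.exp (x / 2) := by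
  have hn : (0 : ℝ) < 2 * (q + 1) := by positivity
  refine ⟨(1 + 2 * (q + 1)) ^ q, by positivity, fun x hx => ?_⟩
  have h1 : 1 + x ≤ (1 + 2 * (q + 1)) * Real.exp (x / (2 * (q + 1))) := by
    have h2 := Real.add_one_le_exp (x / (2 * (q + 1)))
    have h3 : 1 + x ≤ (1 + 2 * (q + 1)) * (x / (2 * (q + 1)) + 1) := by
      have : 0 ≤ x / (2 * (q + 1)) := by positivity
      have h4 : 2 * (q + 1) * (x / (2 * (q + 1))) = x := by field_simp
      nlinarith
    exact h3.trans (by gcongr)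
  calc (1 + x) ^ q ≤ ((1 + 2 * (q + 1)) * Real.exp (x / (2 * (q + 1)))) ^ q := by gcongr
    _ = (1 + 2 * (q + 1)) ^ q * Real.exp (x / (2 * (q + 1)) * q) := by
        rw [Real.mul_rpow (by positivity) (by positivity), ← Real.exp_mul]
    _ ≤ (1 + 2 * (q + 1)) ^ q * Real.exp (x / 2) := by
        gcongr
        rw [div_mul_eq_mul_div, div_le_div_iff₀ hn two_pos]
        nlinarith

/-- Two positive numbers comparable up to a factor `r` have `p`-th powers comparable up to
`r ^ |p|`, for either sign of `p`. -/
theorem rpow_le_mul_rpow_abs {a b r : ℝ} (ha : 0 < a) (hb : 0 < b) (hr : 1 ≤ r)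
    (hab : a ≤ b * r) (hba : b ≤ a * r) (p : ℝ) : a ^ p ≤ r ^ |p| * b ^ p := by
  have hr0 : 0 < r := by linarith
  rcases le_total 0 p with hp | hp
  · rw [abs_of_nonneg hp, ← Real.mul_rpow hr0.le hb.le]
    exact Real.rpow_le_rpow ha.le (by linarith) hp
  · rw [abs_of_nonpos hp, Real.rpow_neg hr0.le, inv_mul_eq_div, le_div_iff₀ (by positivity),
      ← Real.mul_rpow ha.le hr0.le]
    exact Real.rpow_le_rpow_of_nonpos hb hba hp

theorem integrable_exp_neg_abs_half : Integrable fun x : ℝ => Real.exp (-(|x| / 2)) := by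
  rw [← integrableOn_univ, ← Set.Iic_union_Ioi (a := (0 : ℝ))]
  refine IntegrableOn.union ?_ ?_
  · refine (integrableOn_exp_mul_Iic (a := 1 / 2) (by norm_num) 0).congr_fun
      (fun x hx => ?_) measurableSet_Iic
    dsimp only
    rw [abs_of_nonpos hx]
    ring_nf
  · refine (integrableOn_exp_mul_Ioi (a := -(1 / 2)) (by norm_num) 0).congr_fun
      (fun x hx => ?_) measurableSet_Ioi
    dsimp only
    rw [abs_of_pos hx]
    ring_nf

/-- Change of variables by an increasing primitive `F` of a positive function. -/
theorem lintegral_deriv_mul_exp_neg_abs_le {F v : ℝ → ℝ} (hF : ∀ t, HasDerivAt F (v t) t)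
    (hv : ∀ t, 0 < v t) (c : ℝ) :
    ∫⁻ t, ENNReal.ofReal (v t) * ENNReal.ofReal (Real.exp (-(|F t - c| / 2))) ≤
      ∫⁻ x : ℝ, ENNReal.ofReal (Real.exp (-(|x| / 2))) := by
  have hmono : StrictMono F := strictMono_of_deriv_pos fun t => by
    rw [(hF t).deriv]; exact hv t
  have h := lintegral_image_eq_lintegral_abs_deriv_mul MeasurableSet.univ
    (fun t _ => (hF t).hasDerivWithinAt) hmono.injective.injOn
    (fun u => ENNReal.ofReal (Real.exp (-(|u - c| / 2))))
  simp only [Measure.restrict_univ, abs_of_pos (hv _)] at h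
  rw [← h, ← lintegral_sub_right_eq_self (fun x => ENNReal.ofReal (Real.exp (-(|x| / 2)))) c]
  exact setLIntegral_le_lintegral _ _

/-- Weighted Schur row bound for the kernel `exp (-|F t - F s|)`. -/
theorem exists_lintegral_exp_neg_abs_mul_rpow_le (b p : ℝ) :
    ∃ C : ℝ≥0∞, C ≠ ⊤ ∧ ∀ w F : ℝ → ℝ, (∀ t, 0 < w t) → (∀ t, HasDerivAt F (w t ^ b) t) →
      (∀ s t, w t ≤ w s * (1 + |F t - F s|)) → ∀ s,
      ∫⁻ t, ENNReal.ofReal (Real.exp (-|F t - F s|)) * ENNReal.ofReal (w t ^ (b + p)) ≤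
        C * ENNReal.ofReal (w s ^ p) := by
  obtain ⟨M, hM0, hM⟩ := exists_one_add_rpow_le_mul_exp |p| (abs_nonneg p)
  refine ⟨(∫⁻ x : ℝ, ENNReal.ofReal (Real.exp (-(|x| / 2)))) * ENNReal.ofReal M,
    ENNReal.mul_ne_top integrable_exp_neg_abs_half.lintegral_lt_top.ne ENNReal.ofReal_ne_top, ?_⟩
  intro w F hw hF hwF s
  have hpt : ∀ t, ENNReal.ofReal (Real.exp (-|F t - F s|)) * ENNReal.ofReal (w t ^ (b + p)) ≤
      ENNReal.ofReal (w t ^ b) * ENNReal.ofReal (Real.exp (-(|F t - F s| / 2))) *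
        (ENNReal.ofReal M * ENNReal.ofReal (w s ^ p)) := by
    intro t
    have hws := hw s
    have hwt := hw t
    rw [← ENNReal.ofReal_mul (by positivity), ← ENNReal.ofReal_mul (by positivity),
      ← ENNReal.ofReal_mul hM0, ← ENNReal.ofReal_mul (by positivity)]
    apply ENNReal.ofReal_le_ofReal
    have h1 : w t ^ p ≤ (1 + |F t - F s|) ^ |p| * w s ^ p :=
      rpow_le_mul_rpow_abs hwt hws (by simp) (hwF s t) (abs_sub_comm (F s) (F t) ▸ hwF t s) p
    have h2 := hM |F t - F s| (abs_nonneg _)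
    have h3 : Real.exp (-|F t - F s|) * Real.exp (|F t - F s| / 2) =
        Real.exp (-(|F t - F s| / 2)) := by
      rw [← Real.exp_add]; ring_nf
    calc Real.exp (-|F t - F s|) * w t ^ (b + p)
        = Real.exp (-|F t - F s|) * (w t ^ b * w t ^ p) := by rw [Real.rpow_add hwt]
      _ ≤ Real.exp (-|F t - F s|) * (w t ^ b * ((M * Real.exp (|F t - F s| / 2)) * w s ^ p)) := by
          gcongr
          exact h1.trans (by gcongr)
      _ = w t ^ b * Real.exp (-(|F t - F s| / 2)) * (M * w s ^ p) := by rw [← h3]; ring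
  calc _ ≤ ∫⁻ t, ENNReal.ofReal (w t ^ b) * ENNReal.ofReal (Real.exp (-(|F t - F s| / 2))) *
        (ENNReal.ofReal M * ENNReal.ofReal (w s ^ p)) := lintegral_mono hpt
    _ = (∫⁻ t, ENNReal.ofReal (w t ^ b) * ENNReal.ofReal (Real.exp (-(|F t - F s| / 2)))) *
        (ENNReal.ofReal M * ENNReal.ofReal (w s ^ p)) :=
        lintegral_mul_const' _ _ (by finiteness)
    _ ≤ _ := by
        rw [mul_assoc]
        refine mul_le_mul_left ?_ _
        exact lintegral_deriv_mul_exp_neg_abs_le hF (fun t => Real.rpow_pos_of_pos (hw t) b) _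

/-- Cauchy–Schwarz for a kernel `k` with a positive weight `g`. -/
theorem sq_lintegral_mul_le_of_weight {α : Type*} [MeasurableSpace α] {μ : Measure α}
    {k g f : α → ℝ≥0∞} (hk : Measurable k) (hg : Measurable g) (hf : Measurable f)
    (hg0 : ∀ x, g x ≠ 0) (hgt : ∀ x, g x ≠ ⊤) :
    (∫⁻ x, k x * f x ∂μ) ^ 2 ≤
      (∫⁻ x, k x * g x ∂μ) * ∫⁻ x, k x * ((g x)⁻¹ * f x ^ 2) ∂μ := by
  have h := ENNReal.lintegral_mul_le_Lp_mul_Lq (μ.withDensity k) Real.HolderConjugate.two_two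
    (f := fun x => g x ^ (1 / 2 : ℝ)) (g := fun x => (g x)⁻¹ ^ (1 / 2 : ℝ) * f x)
    (by fun_prop) (by fun_prop)
  have e1 : ∀ x, ((fun x => g x ^ (1 / 2 : ℝ)) * fun x => (g x)⁻¹ ^ (1 / 2 : ℝ) * f x) x = f x := by
    intro x
    simp only [Pi.mul_apply]
    rw [← mul_assoc, ← ENNReal.mul_rpow_of_nonneg _ _ (by norm_num),
      ENNReal.mul_inv_cancel (hg0 x) (hgt x), ENNReal.one_rpow, one_mul]
  have e2 : ∀ x, (g x ^ (1 / 2 : ℝ)) ^ (2 : ℝ) = g x := by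
    intro x
    rw [← ENNReal.rpow_mul]; norm_num
  have e3 : ∀ x, ((g x)⁻¹ ^ (1 / 2 : ℝ) * f x) ^ (2 : ℝ) = (g x)⁻¹ * f x ^ 2 := by
    intro x
    rw [ENNReal.mul_rpow_of_nonneg _ _ (by norm_num), ← ENNReal.rpow_mul]; norm_num
  simp only [e1, e2, e3] at h
  rw [lintegral_withDensity_eq_lintegral_mul _ hk hf,
    lintegral_withDensity_eq_lintegral_mul _ hk hg,
    lintegral_withDensity_eq_lintegral_mul _ hk (by fun_prop)] at h
  simp only [Pi.mul_apply] at h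
  calc _ ≤ _ := pow_le_pow_left' h 2
    _ = _ := by
      rw [mul_pow, ← ENNReal.rpow_natCast, ← ENNReal.rpow_natCast, ← ENNReal.rpow_mul,
        ← ENNReal.rpow_mul]
      norm_num

/-- Weighted `L²` bound for the kernel `exp (-|F t - F s|)`, by the Schur test. -/
theorem exists_lintegral_sq_exp_neg_abs_le (b γ : ℝ) :
    ∃ C : ℝ≥0∞, C ≠ ⊤ ∧ ∀ w F : ℝ → ℝ, Measurable w → (∀ t, 0 < w t) →
      (∀ t, HasDerivAt F (w t ^ b) t) → (∀ s t, w t ≤ w s * (1 + |F t - F s|)) →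
      ∀ f : ℝ → ℝ≥0∞, Measurable f →
      ∫⁻ s, ENNReal.ofReal (w s ^ (2 * γ)) *
          (∫⁻ t, ENNReal.ofReal (Real.exp (-|F t - F s|)) * f t) ^ 2 ≤
        C * ∫⁻ t, ENNReal.ofReal (w t ^ (2 * γ - 2 * b)) * f t ^ 2 := by
  obtain ⟨C₁, hC₁, H₁⟩ := exists_lintegral_exp_neg_abs_mul_rpow_le b (-γ)
  obtain ⟨C₂, hC₂, H₂⟩ := exists_lintegral_exp_neg_abs_mul_rpow_le b (γ - b)
  refine ⟨C₁ * C₂, ENNReal.mul_ne_top hC₁ hC₂, ?_⟩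
  intro w F hwm hw hF hwF f hf
  have hFm : Measurable F := (continuous_iff_continuousAt.2 fun t => (hF t).continuousAt).measurable
  have hpos : ∀ (p t : ℝ), 0 < w t ^ p := fun p t => Real.rpow_pos_of_pos (hw t) p
  have hmul : ∀ (p q t : ℝ), ENNReal.ofReal (w t ^ p) * ENNReal.ofReal (w t ^ q) =
      ENNReal.ofReal (w t ^ (p + q)) := fun p q t => by
    rw [← ENNReal.ofReal_mul (hpos p t).le, Real.rpow_add (hw t)]
  have hinv : ∀ (p t : ℝ), (ENNReal.ofReal (w t ^ p))⁻¹ = ENNReal.ofReal (w t ^ (-p)) :=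
    fun p t => by rw [← ENNReal.ofReal_inv_of_pos (hpos p t), Real.rpow_neg (hw t).le]
  have hs : ∀ s, ENNReal.ofReal (w s ^ (2 * γ)) *
      (∫⁻ t, ENNReal.ofReal (Real.exp (-|F t - F s|)) * f t) ^ 2 ≤
      ∫⁻ t, C₁ * (ENNReal.ofReal (w s ^ γ) * (ENNReal.ofReal (Real.exp (-|F t - F s|)) *
        (ENNReal.ofReal (w t ^ (γ - b)) * f t ^ 2))) := by
    intro s
    have hcs := sq_lintegral_mul_le_of_weight (μ := volume)
      (k := fun t => ENNReal.ofReal (Real.exp (-|F t - F s|)))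
      (g := fun t => ENNReal.ofReal (w t ^ (b + -γ))) (f := f) (by fun_prop) (by fun_prop) hf
      (fun t => (ENNReal.ofReal_pos.2 (hpos _ t)).ne') (fun t => ENNReal.ofReal_ne_top)
    simp only [hinv] at hcs
    rw [show -(b + -γ) = γ - b by ring] at hcs
    rw [lintegral_const_mul' _ _ hC₁, lintegral_const_mul' _ _ ENNReal.ofReal_ne_top]
    calc _ ≤ ENNReal.ofReal (w s ^ (2 * γ)) * (C₁ * ENNReal.ofReal (w s ^ (-γ)) *
          ∫⁻ t, ENNReal.ofReal (Real.exp (-|F t - F s|)) *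
            (ENNReal.ofReal (w t ^ (γ - b)) * f t ^ 2)) := by
          gcongr
          exact hcs.trans (by gcongr; exact H₁ w F hw hF hwF s)
      _ = C₁ * ((ENNReal.ofReal (w s ^ (2 * γ)) * ENNReal.ofReal (w s ^ (-γ))) *
          ∫⁻ t, ENNReal.ofReal (Real.exp (-|F t - F s|)) *
            (ENNReal.ofReal (w t ^ (γ - b)) * f t ^ 2)) := by ring
      _ = _ := by rw [hmul, show 2 * γ + -γ = γ by ring]
  have hcol : ∀ t, ∫⁻ s, ENNReal.ofReal (w s ^ γ) * ENNReal.ofReal (Real.exp (-|F t - F s|)) ≤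
      C₂ * ENNReal.ofReal (w t ^ (γ - b)) := by
    intro t
    refine le_trans (le_of_eq (lintegral_congr fun s => ?_)) (H₂ w F hw hF hwF t)
    rw [mul_comm, abs_sub_comm, add_sub_cancel]
  calc _ ≤ ∫⁻ s, ∫⁻ t, C₁ * (ENNReal.ofReal (w s ^ γ) *
        (ENNReal.ofReal (Real.exp (-|F t - F s|)) *
        (ENNReal.ofReal (w t ^ (γ - b)) * f t ^ 2))) := lintegral_mono hs
    _ = ∫⁻ t, ∫⁻ s, C₁ * (ENNReal.ofReal (w s ^ γ) *
        (ENNReal.ofReal (Real.exp (-|F t - F s|)) *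
        (ENNReal.ofReal (w t ^ (γ - b)) * f t ^ 2))) :=
        lintegral_lintegral_swap (by
          apply Measurable.aemeasurable
          simp only [Function.uncurry_def]
          fun_prop)
    _ = ∫⁻ t, C₁ * ((∫⁻ s, ENNReal.ofReal (w s ^ γ) *
        ENNReal.ofReal (Real.exp (-|F t - F s|))) *
        (ENNReal.ofReal (w t ^ (γ - b)) * f t ^ 2)) := by
        refine lintegral_congr fun t => ?_
        rw [lintegral_const_mul' _ _ hC₁, ← lintegral_mul_const _ (by fun_prop)]
        simp only [mul_assoc]
    _ ≤ ∫⁻ t, C₁ * (C₂ * ENNReal.ofReal (w t ^ (γ - b)) *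
        (ENNReal.ofReal (w t ^ (γ - b)) * f t ^ 2)) := by
        gcongr with t
        exact hcol t
    _ = ∫⁻ t, C₁ * C₂ * (ENNReal.ofReal (w t ^ (2 * γ - 2 * b)) * f t ^ 2) := by
        refine lintegral_congr fun t => ?_
        rw [show 2 * γ - 2 * b = (γ - b) + (γ - b) by ring, ← hmul]
        ring
    _ = _ := lintegral_const_mul' _ _ (ENNReal.mul_ne_top hC₁ hC₂)

section Weight

variable {β : ℝ} {d : ℕ} {φ ξ : EuclideanSpace ℝ (Fin d)}

theorem continuous_Wgt : Continuous fun t => Wgt β t φ ξ := by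
  unfold Wgt
  fun_prop

theorem Wgt_pos (h : (φ, ξ) ≠ (0, 0)) (t : ℝ) : 0 < Wgt β t φ ξ := by
  unfold Wgt
  by_cases hφ : φ = 0
  · have hξ : ξ ≠ 0 := fun hξ => h (by rw [hφ, hξ])
    exact lt_max_of_lt_left (by simpa [hφ] using hξ)
  · exact lt_max_of_lt_right (Real.rpow_pos_of_pos (norm_pos_iff.2 hφ) _)

/-- The number `a = N^{1/(1+2β)}` satisfies `a * a^{2β} = N`. -/
theorem rpow_mul_rpow_rpow_eq {N : ℝ} (hβ : 0 < β) (hN : 0 ≤ N) :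
    N ^ (1 / (1 + 2 * β)) * (N ^ (1 / (1 + 2 * β))) ^ (2 * β) = N := by
  have h : (0 : ℝ) < 1 + 2 * β := by positivity
  rw [← Real.rpow_one_add' (by positivity) h.ne', ← Real.rpow_mul hN, one_div_mul_cancel h.ne',
    Real.rpow_one]

theorem Wgt_le_add (s t : ℝ) : Wgt β t φ ξ ≤ Wgt β s φ ξ + ‖φ‖ * |t - s| := by
  have h0 : 0 ≤ ‖φ‖ * |t - s| := by positivity
  refine max_le ?_ ((le_max_right _ _).trans (le_add_of_nonneg_right h0))
  have h : ξ - t • φ = (ξ - s • φ) - (t - s) • φ := by rw [sub_smul]; abel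
  calc ‖ξ - t • φ‖ ≤ ‖ξ - s • φ‖ + ‖(t - s) • φ‖ := h ▸ norm_sub_le _ _
    _ ≤ Wgt β s φ ξ + ‖φ‖ * |t - s| := by
      rw [norm_smul, Real.norm_eq_abs, mul_comm ‖φ‖]
      gcongr
      exact le_max_left _ _

theorem continuous_Wgt_rpow (hβ : 0 < β) : Continuous fun t => Wgt β t φ ξ ^ (2 * β) :=
  continuous_Wgt.rpow_const fun _ => Or.inr (by positivity)

theorem mul_abs_sub_le_abs_integral_Wgt (hβ : 0 < β) (s t : ℝ) :
    (‖φ‖ ^ (1 / (1 + 2 * β))) ^ (2 * β) * |t - s| ≤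
      |∫ τ in s..t, Wgt β τ φ ξ ^ (2 * β)| := by
  wlog hst : s ≤ t generalizing s t
  · rw [intervalIntegral.integral_symm, abs_neg, abs_sub_comm]
    exact this t s (le_of_not_ge hst)
  have h := intervalIntegral.integral_mono_on hst (μ := volume)
    (f := fun _ => (‖φ‖ ^ (1 / (1 + 2 * β))) ^ (2 * β)) (g := fun τ => Wgt β τ φ ξ ^ (2 * β))
    intervalIntegrable_const ((continuous_Wgt_rpow hβ).intervalIntegrable _ _)
    (fun τ _ => Real.rpow_le_rpow (by positivity) (le_max_right _ _) (by positivity))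
  rw [intervalIntegral.integral_const, smul_eq_mul] at h
  rw [abs_of_nonneg (sub_nonneg.2 hst), mul_comm]
  exact h.trans (le_abs_self _)

theorem Wgt_le_mul_one_add (hβ : 0 < β) (s t : ℝ) :
    Wgt β t φ ξ ≤ Wgt β s φ ξ * (1 + |∫ τ in s..t, Wgt β τ φ ξ ^ (2 * β)|) := by
  have h2 := mul_abs_sub_le_abs_integral_Wgt (φ := φ) (ξ := ξ) hβ s t
  have h3 : ‖φ‖ ^ (1 / (1 + 2 * β)) ≤ Wgt β s φ ξ := le_max_right _ _
  have h4 := rpow_mul_rpow_rpow_eq hβ (norm_nonneg φ)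
  calc Wgt β t φ ξ ≤ Wgt β s φ ξ + ‖φ‖ * |t - s| := Wgt_le_add s t
    _ = Wgt β s φ ξ + ‖φ‖ ^ (1 / (1 + 2 * β)) *
        ((‖φ‖ ^ (1 / (1 + 2 * β))) ^ (2 * β) * |t - s|) := by rw [← mul_assoc, h4]
    _ ≤ Wgt β s φ ξ + Wgt β s φ ξ * |∫ τ in s..t, Wgt β τ φ ξ ^ (2 * β)| := by
        gcongr
        exact (by positivity : (0 : ℝ) ≤ _).trans h3
    _ = _ := by ring

theorem volume_norm_sub_smul_lt_le {a : ℝ} (ha : φ = 0 → a = 0) :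
    volume {τ : ℝ | ‖ξ - τ • φ‖ < a} ≤ ENNReal.ofReal (2 * a / ‖φ‖) := by
  by_cases hφ : φ = 0
  · have : {τ : ℝ | ‖ξ - τ • φ‖ < a} = ∅ := by
      ext τ
      simp [ha hφ, (norm_nonneg _).not_gt]
    simp [this]
  refine (Real.volume_le_diam _).trans (Metric.ediam_le fun x hx y hy => ?_)
  rw [edist_dist]
  apply ENNReal.ofReal_le_ofReal
  rw [le_div_iff₀ (norm_pos_iff.2 hφ), Real.dist_eq, ← Real.norm_eq_abs, ← norm_smul]
  have h : (x - y) • φ = (ξ - y • φ) - (ξ - x • φ) := by rw [sub_smul]; abel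
  rw [h]
  have := norm_sub_le (ξ - y • φ) (ξ - x • φ)
  simp only [Set.mem_ofPred_eq] at hx hy
  linarith

theorem integral_Wgt_rpow_le (hβ : 0 < β) {s t : ℝ} (hst : s ≤ t) :
    ∫ τ in s..t, Wgt β τ φ ξ ^ (2 * β) ≤ (∫ τ in s..t, ‖ξ - τ • φ‖ ^ (2 * β)) + 2 := by
  set a : ℝ := ‖φ‖ ^ (1 / (1 + 2 * β)) with ha
  have ha0 : 0 ≤ a := by positivity
  have hφa : φ = 0 → a = 0 := fun h => by
    rw [ha, h, norm_zero, Real.zero_rpow (by positivity)]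
  have hmul : a * a ^ (2 * β) = ‖φ‖ := rpow_mul_rpow_rpow_eq hβ (norm_nonneg φ)
  set S : Set ℝ := {τ : ℝ | ‖ξ - τ • φ‖ < a} with hS
  have hSm : MeasurableSet S := (isOpen_lt (by fun_prop) continuous_const).measurableSet
  have hvol : volume S ≤ ENNReal.ofReal (2 * a / ‖φ‖) := volume_norm_sub_smul_lt_le hφa
  have hvolr : volume.real S ≤ 2 * a / ‖φ‖ :=
    ENNReal.toReal_le_of_le_ofReal (by positivity) hvol
  have hind : Integrable (S.indicator fun _ => a ^ (2 * β)) :=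
    (integrable_indicator_iff hSm).2 (integrableOn_const (hvol.trans_lt ENNReal.ofReal_lt_top).ne)
  have hc : Continuous fun τ : ℝ => ‖ξ - τ • φ‖ ^ (2 * β) :=
    Continuous.rpow_const (by fun_prop) fun _ => Or.inr (by positivity)
  have hle : ∫ τ in s..t, Wgt β τ φ ξ ^ (2 * β) ≤
      ∫ τ in s..t, (‖ξ - τ • φ‖ ^ (2 * β) + S.indicator (fun _ => a ^ (2 * β)) τ) := by
    refine intervalIntegral.integral_mono_on hst ((continuous_Wgt_rpow hβ).intervalIntegrable _ _)
      ((hc.intervalIntegrable _ _).add hind.intervalIntegrable) fun τ _ => ?_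
    by_cases hτ : τ ∈ S
    · rw [Set.indicator_of_mem hτ, Wgt, ← ha, max_eq_right (le_of_lt hτ)]
      exact le_add_of_nonneg_left (by positivity)
    · rw [Set.indicator_of_notMem hτ, Wgt, ← ha, max_eq_left (not_lt.1 hτ), add_zero]
  rw [intervalIntegral.integral_add (hc.intervalIntegrable _ _) hind.intervalIntegrable] at hle
  refine hle.trans (add_le_add_right ?_ _)
  calc ∫ τ in s..t, S.indicator (fun _ => a ^ (2 * β)) τ
      ≤ ∫ τ, S.indicator (fun _ => a ^ (2 * β)) τ := by
        rw [intervalIntegral.integral_of_le hst]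
        exact setIntegral_le_integral hind
          (ae_of_all _ fun τ => Set.indicator_nonneg (fun _ _ => by positivity) τ)
    _ = volume.real S * a ^ (2 * β) := by
        rw [integral_indicator hSm, setIntegral_const, smul_eq_mul]
    _ ≤ 2 * a / ‖φ‖ * a ^ (2 * β) := by gcongr
    _ = 2 * (‖φ‖ / ‖φ‖) := by rw [← hmul]; ring
    _ ≤ 2 := by linarith [div_self_le_one ‖φ‖]

theorem Kker_le (hβ : 0 < β) {s t : ℝ} (hst : s ≤ t) :
    Kker β t s φ ξ ≤ Real.exp 2 * Real.exp (-|∫ τ in s..t, Wgt β τ φ ξ ^ (2 * β)|) := by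
  have h0 : 0 ≤ ∫ τ in s..t, Wgt β τ φ ξ ^ (2 * β) :=
    intervalIntegral.integral_nonneg hst fun τ _ =>
      Real.rpow_nonneg ((norm_nonneg _).trans (le_max_left _ _)) _
  rw [Kker, abs_of_nonneg h0, ← Real.exp_add]
  apply Real.exp_le_exp.2
  linarith [integral_Wgt_rpow_le (φ := φ) (ξ := ξ) hβ hst]

end Weight

/-- Proposition 2.16 for the adjoint operator `T*`:
`T* : L²(W^{2γ-4β}) → L²(W^{2γ})` is bounded, with a constant depending only on `β`
and `γ`. -/
theorem adjoint_duhamel_L2_to_L2 (β γ : ℝ) (hβ : 0 < β) :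
    ∃ C : ℝ≥0∞, C ≠ ⊤ ∧
      ∀ (d : ℕ), 1 ≤ d → ∀ φ ξ : EuclideanSpace ℝ (Fin d), (φ, ξ) ≠ (0, 0) →
        ∀ f : ℝ → ℝ≥0∞, Measurable f →
          (∫⁻ s : ℝ, ENNReal.ofReal (Wgt β s φ ξ ^ (2 * γ)) *
              (∫⁻ t in Set.Ici s, ENNReal.ofReal (Kker β t s φ ξ) * f t) ^ 2)
            ≤ C * ∫⁻ t : ℝ, ENNReal.ofReal (Wgt β t φ ξ ^ (2 * γ - 4 * β)) * f t ^ 2 := by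
  obtain ⟨C, hC, H⟩ := exists_lintegral_sq_exp_neg_abs_le (2 * β) γ
  refine ⟨ENNReal.ofReal (Real.exp 2) ^ 2 * C, by finiteness, ?_⟩
  intro d _ φ ξ hφξ f hf
  have hcont := continuous_Wgt_rpow (φ := φ) (ξ := ξ) hβ
  set F : ℝ → ℝ := fun t => ∫ τ in (0 : ℝ)..t, Wgt β τ φ ξ ^ (2 * β) with hFdef
  have hFsub : ∀ s t, F t - F s = ∫ τ in s..t, Wgt β τ φ ξ ^ (2 * β) := fun s t =>
    intervalIntegral.integral_interval_sub_left (hcont.intervalIntegrable _ _)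
      (hcont.intervalIntegrable _ _)
  have hF : ∀ t, HasDerivAt F (Wgt β t φ ξ ^ (2 * β)) t := fun t =>
    hcont.integral_hasStrictDerivAt 0 t |>.hasDerivAt
  have key := H (fun t => Wgt β t φ ξ) F continuous_Wgt.measurable (Wgt_pos hφξ) hF
    (fun s t => by rw [hFsub]; exact Wgt_le_mul_one_add hβ s t) f hf
  rw [show 2 * γ - 2 * (2 * β) = 2 * γ - 4 * β by ring] at key
  have hinner : ∀ s, ∫⁻ t in Set.Ici s, ENNReal.ofReal (Kker β t s φ ξ) * f t ≤
      ENNReal.ofReal (Real.exp 2) * ∫⁻ t, ENNReal.ofReal (Real.exp (-|F t - F s|)) * f t := by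
    intro s
    rw [← lintegral_const_mul' _ _ ENNReal.ofReal_ne_top]
    refine (setLIntegral_mono' measurableSet_Ici fun t ht => ?_).trans
      (setLIntegral_le_lintegral (Set.Ici s) _)
    rw [← mul_assoc, ← ENNReal.ofReal_mul (Real.exp_pos 2).le, hFsub]
    gcongr
    exact Kker_le hβ ht
  calc _ ≤ ∫⁻ s, ENNReal.ofReal (Real.exp 2) ^ 2 * (ENNReal.ofReal (Wgt β s φ ξ ^ (2 * γ)) *
        (∫⁻ t, ENNReal.ofReal (Real.exp (-|F t - F s|)) * f t) ^ 2) := by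
        refine lintegral_mono fun s => ?_
        rw [mul_left_comm, ← mul_pow]
        gcongr
        exact hinner s
    _ = ENNReal.ofReal (Real.exp 2) ^ 2 * ∫⁻ s, ENNReal.ofReal (Wgt β s φ ξ ^ (2 * γ)) *
        (∫⁻ t, ENNReal.ofReal (Real.exp (-|F t - F s|)) * f t) ^ 2 :=
        lintegral_const_mul' _ _ (by finiteness)
    _ ≤ _ := by
        rw [mul_assoc]
        gcongr
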